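/- arXiv:2412.04962 — 3 statements merged into one kernel-verified Lean document; each statement's English description precedes it below -/
import Mathlib

section
/- The graph X(2e,K) is a divisible design graph with parameters (v,k,λ1,λ2,m,n) where v = q^{2e-1}(q^{2e}-1)/(q-1), k = q^{4e-2}+q^{4e-3}-q^{2e-2}, λ1 = q^{4e-2}+q^{4e-3}-q^{4e-4}-q^{2e-2}, λ2 = q^{4e-2}+q^{4e-3}-q^{4e-4}-q^{4e-5}-q^{2e-2}+q^{2e-3}, m = (q^{2e}-1)/(q-1), n = q^{2e-1}. That is: X(2e,K) has exactly v vertices, every vertex has degree exactly k, and there is a partition of the vertex set into m classes each of cardinality n such that any two distinct vertices from the same class have exactly λ1 common neighbours and any two vertices from different classes have exactly λ2 common neighbours. -/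
open Matrix

/-- The symplectic form `a M bᵀ` where `M = [[0, Iₑ],[-Iₑ, 0]]`. -/
def sympForm (K : Type) [CommRing K] (e : ℕ) (a b : Fin e ⊕ Fin e → K) : K :=
  a ⬝ᵥ ((Matrix.fromBlocks (0 : Matrix (Fin e) (Fin e) K) 1 (-1) 0) *ᵥ b)

/-- `V'`: the set of 2e-tuples over `K` having at least one unit entry. -/
def unitTuples (K : Type) [CommRing K] (e : ℕ) : Set (Fin e ⊕ Fin e → K) :=
  {a | ∃ i, IsUnit (a i)}

/-- The equivalence class `[a]` of a tuple under unit scaling. -/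
def cls (K : Type) [CommRing K] (e : ℕ) (a : Fin e ⊕ Fin e → K) :
    Set (Fin e ⊕ Fin e → K) :=
  {b | ∃ σ : Kˣ, b = σ • a}

/-- `V`: the set of equivalence classes of elements of `V'` under unit scaling. -/
def classes (K : Type) [CommRing K] (e : ℕ) : Set (Set (Fin e ⊕ Fin e → K)) :=
  {S | ∃ a ∈ unitTuples K e, S = cls K e a}

/-- Adjacency in the graph `X(2e,K)`: `a M bᵀ ∈ K \ {0}`. -/
def adjX (K : Type) [CommRing K] (e : ℕ) (A B : Set (Fin e ⊕ Fin e → K)) : Prop :=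
  ∃ a ∈ A, ∃ b ∈ B, sympForm K e a b ≠ 0

/-- Adjacency in the complement of `X(2e,K)`: distinct classes with `a M bᵀ = 0`. -/
def adjXc (K : Type) [CommRing K] (e : ℕ) (A B : Set (Fin e ⊕ Fin e → K)) : Prop :=
  A ≠ B ∧ ∃ a ∈ A, ∃ b ∈ B, sympForm K e a b = 0

/-- Adjacency in the graph `Y(2e,K)`: `a M bᵀ ∈ J \ {0}`. -/
def adjY (K : Type) [CommRing K] (J : Ideal K) (e : ℕ)
    (A B : Set (Fin e ⊕ Fin e → K)) : Prop :=
  ∃ a ∈ A, ∃ b ∈ B, sympForm K e a b ∈ J ∧ sympForm K e a b ≠ 0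

/-- `T = J × ⋯ × J` (2e factors), as a subset of `K^{2e}`. -/
def Tset (K : Type) [CommRing K] (J : Ideal K) (e : ℕ) : Set (Fin e ⊕ Fin e → K) :=
  {x | ∀ i, x i ∈ J}

/-- A hyperplane of `T`: a `K`-submodule contained in `T` of cardinality `q^(2e-1)`. -/
def IsHyperplane (K : Type) [CommRing K] (J : Ideal K) (e q : ℕ)
    (H : Submodule K (Fin e ⊕ Fin e → K)) : Prop :=
  (H : Set (Fin e ⊕ Fin e → K)) ⊆ Tset K J e ∧ Nat.card H = q ^ (2 * e - 1)

/-- `C(H,u) = {[u+h] : h ∈ H}`. -/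
def classSet (K : Type) [CommRing K] (e : ℕ) (H : Submodule K (Fin e ⊕ Fin e → K))
    (u : Fin e ⊕ Fin e → K) : Set (Set (Fin e ⊕ Fin e → K)) :=
  {S | ∃ h ∈ (H : Set (Fin e ⊕ Fin e → K)), S = cls K e (u + h)}

/-- The set of tuples `{σ • (u+h) : σ ∈ Kˣ, h ∈ H}`. -/
def orbitSet (K : Type) [CommRing K] (e : ℕ) (H : Submodule K (Fin e ⊕ Fin e → K))
    (u : Fin e ⊕ Fin e → K) : Set (Fin e ⊕ Fin e → K) :=
  {x | ∃ σ : Kˣ, ∃ h ∈ (H : Set (Fin e ⊕ Fin e → K)), x = σ • (u + h)}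

/-- The coset `c • u + T` of `T`. -/
def cosetOf (K : Type) [CommRing K] (J : Ideal K) (e : ℕ) (c : K)
    (u : Fin e ⊕ Fin e → K) : Set (Fin e ⊕ Fin e → K) :=
  {x | ∃ t ∈ Tset K J e, x = c • u + t}

section Counting

theorem ncard_eq_zero_mul_card {G H : Type*} [AddGroup G] [AddGroup H] [Finite G]
    (f : G →+ H) (hf : Function.Surjective f) :
    {x | f x = 0}.ncard * Nat.card H = Nat.card G := by
  have h := f.ker.card_mul_index
  rw [AddSubgroup.index_ker, f.range_eq_top.2 hf, AddSubgroup.card_top] at h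
  exact h

theorem ncard_diff_union {α : Type*} [Finite α] (T A B : Set α) :
    ((Tᶜ \ (A ∪ B)).ncard : ℤ) = Nat.card α - T.ncard - (A.ncard - (T ∩ A).ncard)
      - (B.ncard - (T ∩ B).ncard) + ((A ∩ B).ncard - (T ∩ (A ∩ B)).ncard) := by
  have h1 := Set.ncard_add_ncard_compl (T ∪ (A ∪ B))
  have h2 := Set.ncard_union_add_ncard_inter T (A ∪ B)
  have h3 := Set.ncard_union_add_ncard_inter A B
  have h4 := Set.ncard_union_add_ncard_inter (T ∩ A) (T ∩ B)
  rw [← Set.inter_union_distrib_left, ← Set.inter_inter_distrib_left] at h4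
  rw [Set.compl_union, ← Set.sdiff_eq] at h1
  omega

theorem ncard_mem_ideal_and {K ι : Type*} [CommRing K] (J : Ideal K) (p : (ι → K) → Prop) :
    {c : ι → K | (∀ i, c i ∈ J) ∧ p c}.ncard = {c : ι → J | p fun i => c i}.ncard := by
  symm
  refine Set.ncard_congr (fun c _ i => (c i : K)) ?_ ?_ ?_
  · exact fun c hc => ⟨fun i => (c i).2, hc⟩
  · exact fun c d _ _ h => funext fun i => Subtype.ext (congrFun h i)
  · exact fun c hc => ⟨fun i => ⟨c i, hc.1 i⟩, hc.2, rfl⟩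

variable {K ι M : Type*} [CommRing K] [Fintype ι] [AddCommGroup M] [Module K M]

/-- The map `c ↦ ∑ i, w i • c i` on tuples in a module. -/
def combination (M : Type*) [AddCommGroup M] [Module K M] (w : ι → K) : (ι → M) →ₗ[K] M :=
  ∑ i, w i • LinearMap.proj i

theorem combination_apply (w : ι → K) (c : ι → M) :
    combination M w c = ∑ i, w i • c i := by
  simp [combination]

theorem combination_single [DecidableEq ι] (w : ι → K) (i : ι) (x : M) :
    combination M w (Pi.single i x) = w i • x := by
  rw [combination_apply, Finset.sum_eq_single i] <;> simp +contextual

theorem combination_sub_smul (w w' : ι → K) (s : K) (c : ι → M) :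
    combination M (w' - s • w) c = combination M w' c - s • combination M w c := by
  simp [combination_apply, sub_smul, Finset.sum_sub_distrib, Finset.smul_sum, mul_smul]

theorem ncard_combination_eq_zero [Finite M] {w : ι → K} {i : ι} (hi : IsUnit (w i)) :
    {c : ι → M | combination M w c = 0}.ncard * Nat.card M
      = Nat.card M ^ Fintype.card ι := by
  classical
  obtain ⟨u, hu⟩ := hi
  rw [← Nat.card_eq_fintype_card, ← Nat.card_fun]
  refine ncard_eq_zero_mul_card (combination M w).toAddMonoidHom fun x => ?_
  refine ⟨Pi.single i ((u⁻¹ : Kˣ) • x), ?_⟩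
  change combination M w _ = x
  rw [combination_single, ← hu]
  exact smul_inv_smul u x

/-- Joint kernel of two functionals, the second of which takes values in the submodule
`N` and stays onto `N` after subtracting any multiple of the first. -/
theorem ncard_combination_pair_eq_zero [Finite M] (N : Submodule K M) {w w' : ι → K} {i : ι}
    (hi : IsUnit (w i)) (hN : ∀ c : ι → M, combination M w' c ∈ N)
    (h : ∀ s : K, ∃ j, ∀ y ∈ N, ∃ x : M, (w' j - s * w j) • x = y) :
    {c : ι → M | combination M w c = 0 ∧ combination M w' c = 0}.ncard
        * (Nat.card M * Nat.card N) = Nat.card M ^ Fintype.card ι := by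
  classical
  obtain ⟨u, hu⟩ := hi
  obtain ⟨j, hj⟩ := h (w' i * (u⁻¹ : Kˣ))
  rw [← Nat.card_eq_fintype_card, ← Nat.card_fun, ← Nat.card_prod]
  let f : (ι → M) →ₗ[K] M × N :=
    (combination M w).prod ((combination M w').codRestrict N hN)
  have hf : Function.Surjective f.toAddMonoidHom := by
    rintro ⟨x, y, hy⟩
    set s : K := w' i * (u⁻¹ : Kˣ) with hs
    have hsi : w' i = s * w i := by rw [← hu, hs]; simp
    have hsx : s • x ∈ N := by
      have := hN (Pi.single i ((u⁻¹ : Kˣ) • x))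
      rwa [combination_single, Units.smul_def, smul_smul] at this
    obtain ⟨z, hz⟩ := hj (y - s • x) (N.sub_mem hy hsx)
    let c : ι → M := Pi.single i ((u⁻¹ : Kˣ) • (x - w j • z)) + Pi.single j z
    have key : combination M w c = x := by
      rw [map_add, combination_single, combination_single, ← hu, ← Units.smul_def,
        smul_inv_smul, sub_add_cancel]
    refine ⟨c, Prod.ext key (Subtype.ext ?_)⟩
    change combination M w' c = y
    have h2 := combination_sub_smul w w' s c
    rw [key, map_add, combination_single, combination_single] at h2
    simp only [Pi.sub_apply, Pi.smul_apply, smul_eq_mul, hz, hsi, sub_self, zero_smul,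
      zero_add] at h2
    exact (sub_left_inj.1 h2).symm
  rw [← ncard_eq_zero_mul_card f.toAddMonoidHom hf]
  congr 2
  ext c
  simp [f, Prod.ext_iff, Subtype.ext_iff]

theorem combination_coe (J : Ideal K) (w : ι → K) (c : ι → J) :
    combination K w (fun i => (c i : K)) = combination J w c := by
  simp [combination_apply]

theorem combination_mem {J : Ideal K} {w : ι → K} (hw : ∀ i, w i ∈ J) (c : ι → K) :
    combination K w c ∈ J := by
  rw [combination_apply]
  exact J.sum_mem fun i _ => J.mul_mem_right _ (hw i)

theorem ncard_mem_ideal (J : Ideal K) :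
    {c : ι → K | ∀ i, c i ∈ J}.ncard = Nat.card J ^ Fintype.card ι := by
  have h := ncard_mem_ideal_and (ι := ι) J fun _ => True
  simp only [and_true, Set.ofPred_true, Set.ncard_univ, Nat.card_fun] at h
  rw [h, Nat.card_eq_fintype_card (α := ι)]

theorem ncard_mem_ideal_and_combination [Finite K] (J : Ideal K) {w : ι → K} {i : ι}
    (hi : IsUnit (w i)) :
    {c : ι → K | (∀ i, c i ∈ J) ∧ combination K w c = 0}.ncard * Nat.card J
      = Nat.card J ^ Fintype.card ι := by
  rw [ncard_mem_ideal_and]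
  simp only [combination_coe, ZeroMemClass.coe_eq_zero]
  exact ncard_combination_eq_zero hi

end Counting

section Ring

/-- `K` is local with maximal ideal `J`, every nonzero element of `J` generates it,
`J ^ 2 = 0`, and `J` and `K` have orders `q` and `q ^ 2`. -/
structure IsLengthTwo {K : Type} [CommRing K] (J : Ideal K) (q : ℕ) : Prop where
  isUnit_iff : ∀ x, IsUnit x ↔ x ∉ J
  exists_mul : ∀ y ∈ J, y ≠ 0 → ∀ z ∈ J, ∃ x, y * x = z
  mul_eq_zero : ∀ x ∈ J, ∀ y ∈ J, x * y = 0
  card_ideal : Nat.card J = q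
  card_ring : Nat.card K = q ^ 2

theorem isLengthTwo_of_ideals {K : Type} [CommRing K] [Finite K] {J : Ideal K} {q : ℕ}
    (hJbot : J ≠ ⊥) (hJtop : J ≠ ⊤) (hideals : ∀ I : Ideal K, I = ⊥ ∨ I = J ∨ I = ⊤)
    (hqcard : Nat.card (K ⧸ J) = q) : IsLengthTwo J q := by
  have hunit : ∀ x, IsUnit x ↔ x ∉ J := by
    intro x
    refine ⟨fun hx hxJ => hJtop (J.eq_top_of_isUnit_mem hxJ hx), fun hx => ?_⟩
    have hmem := Ideal.mem_span_singleton_self x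
    rcases hideals (Ideal.span {x}) with h | h | h
    · rw [h, Ideal.mem_bot] at hmem
      exact absurd (hmem ▸ J.zero_mem) hx
    · exact absurd (h ▸ hmem) hx
    · exact Ideal.span_singleton_eq_top.1 h
  have hgen : ∀ y ∈ J, y ≠ 0 → Ideal.span {y} = J := by
    intro y hy hy0
    rcases hideals (Ideal.span {y}) with h | h | h
    · exact absurd (Ideal.span_singleton_eq_bot.1 h) hy0
    · exact h
    · exact absurd hy ((hunit y).1 (Ideal.span_singleton_eq_top.1 h))
  obtain ⟨r, hrJ, hr0⟩ := J.ne_bot_iff.1 hJbot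
  have hrr : r * r = 0 := by
    by_contra hne
    have hr : r ∈ Ideal.span {r * r} := by rwa [hgen _ (J.mul_mem_left r hrJ) hne]
    obtain ⟨s, hs⟩ := Ideal.mem_span_singleton'.1 hr
    have hu : IsUnit (1 - s * r) := (hunit _).2 fun h =>
      J.ne_top_iff_one.1 hJtop (by simpa using J.add_mem h (J.mul_mem_left s hrJ))
    exact hr0 (hu.mul_right_eq_zero.1 (by linear_combination -hs))
  have hmul : ∀ x, x * r = 0 ↔ x ∈ J := by
    intro x
    constructor
    · intro h
      by_contra hx
      exact hr0 (((hunit x).2 hx).mul_right_eq_zero.1 h)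
    · intro h
      rw [← hgen r hrJ hr0] at h
      obtain ⟨s, rfl⟩ := Ideal.mem_span_singleton'.1 h
      rw [mul_assoc, hrr, mul_zero]
  have hcard : Nat.card J = q := by
    let f : K →ₗ[K] K := LinearMap.toSpanSingleton K K r
    have hker : LinearMap.ker f = J := by
      ext x
      simp [f, hmul]
    have hrange : LinearMap.range f = J := by
      rw [← hgen r hrJ hr0]
      exact LinearMap.range_toSpanSingleton r
    have h := Nat.card_congr f.quotKerEquivRange.toEquiv
    rw [hker, hrange] at h
    exact h.symm.trans hqcard
  refine ⟨hunit, fun y hy hy0 z hz => ?_, fun x hx y hy => ?_, hcard, ?_⟩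
  · rw [← hgen y hy hy0] at hz
    obtain ⟨x, hx⟩ := Ideal.mem_span_singleton'.1 hz
    exact ⟨x, by rw [mul_comm, hx]⟩
  · rw [← hgen r hrJ hr0] at hy
    obtain ⟨s, rfl⟩ := Ideal.mem_span_singleton'.1 hy
    rw [mul_left_comm, (hmul x).2 hx, mul_zero]
  · rw [J.card_eq_card_quotient_mul_card, hqcard, hcard, sq]

variable {K : Type} [CommRing K] {J : Ideal K} {q : ℕ}

theorem IsLengthTwo.card_units_add [Finite K] (hK : IsLengthTwo J q) :
    Nat.card Kˣ + q = q ^ 2 := by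
  have h : {x : K | x ∉ J}.ncard = Nat.card Kˣ := by
    rw [← Nat.card_coe_set_eq]
    refine (Nat.card_congr (Equiv.ofBijective
      (fun u : Kˣ => (⟨u, (hK.isUnit_iff _).1 u.isUnit⟩ : {x : K | x ∉ J})) ⟨?_, ?_⟩)).symm
    · exact fun u v huv => Units.ext (Subtype.ext_iff.1 huv)
    · rintro ⟨x, hx⟩
      obtain ⟨u, rfl⟩ := (hK.isUnit_iff x).2 hx
      exact ⟨u, rfl⟩
  have h2 := Set.ncard_add_ncard_compl (J : Set K)
  rw [hK.card_ring, ← Nat.card_coe_set_eq (J : Set K)] at h2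
  rw [← h, ← h2, add_comm, ← hK.card_ideal]
  rfl

theorem mem_of_isUnit_mul_mem {x y : K} (hx : IsUnit x)
    (h : x * y ∈ J) : y ∈ J := by
  obtain ⟨u, rfl⟩ := hx
  simpa using J.mul_mem_left (u⁻¹ : Kˣ) h

theorem IsLengthTwo.isUnit_add (hK : IsLengthTwo J q) {x y : K} (hx : IsUnit x) (hy : y ∈ J) :
    IsUnit (x + y) := by
  rw [hK.isUnit_iff] at hx ⊢
  rwa [J.add_mem_iff_left hy]

theorem IsLengthTwo.mem_unitTuples_iff (hK : IsLengthTwo J q) {e : ℕ} {a : Fin e ⊕ Fin e → K} :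
    a ∈ unitTuples K e ↔ ¬∀ i, a i ∈ J := by
  rw [not_forall]
  exact exists_congr fun i => hK.isUnit_iff _

theorem IsLengthTwo.add_mem_unitTuples (hK : IsLengthTwo J q) {e : ℕ}
    {a t : Fin e ⊕ Fin e → K} (ha : a ∈ unitTuples K e) (ht : ∀ i, t i ∈ J) :
    a + t ∈ unitTuples K e := by
  obtain ⟨i, hi⟩ := ha
  exact ⟨i, hK.isUnit_add hi (ht i)⟩

end Ring

section Symplectic

variable {K : Type} [CommRing K] {J : Ideal K} {q e : ℕ}

/-- The row vector `a M`. -/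
def dualVec (a : Fin e ⊕ Fin e → K) : Fin e ⊕ Fin e → K :=
  Sum.elim (fun i => -a (Sum.inr i)) fun i => a (Sum.inl i)

theorem sympForm_eq_combination (a c : Fin e ⊕ Fin e → K) :
    sympForm K e a c = combination K (dualVec a) c := by
  simp [sympForm, combination_apply, dualVec, dotProduct, Matrix.fromBlocks_mulVec, add_comm,
    Matrix.neg_mulVec]

theorem sympForm_swap (a c : Fin e ⊕ Fin e → K) : sympForm K e c a = -sympForm K e a c := by
  simp [sympForm_eq_combination, combination_apply, dualVec, mul_comm, add_comm]

theorem sympForm_smul_smul (s t : K) (a c : Fin e ⊕ Fin e → K) :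
    sympForm K e (s • a) (t • c) = s * t * sympForm K e a c := by
  rw [sympForm, sympForm, smul_dotProduct, Matrix.mulVec_smul, dotProduct_smul, smul_eq_mul,
    smul_eq_mul, mul_assoc]

theorem exists_dualVec_iff {p : K → Prop} (hp : ∀ x, p (-x) ↔ p x) (a : Fin e ⊕ Fin e → K) :
    (∃ i, p (dualVec a i)) ↔ ∃ i, p (a i) := by
  simp [dualVec, hp, or_comm]

theorem exists_dualVec_isUnit {a : Fin e ⊕ Fin e → K} (ha : a ∈ unitTuples K e) :
    ∃ i, IsUnit (dualVec a i) :=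
  (exists_dualVec_iff (fun x => IsUnit.neg_iff x) a).2 ha

theorem dualVec_sub_smul (a b : Fin e ⊕ Fin e → K) (s : K) (i : Fin e ⊕ Fin e) :
    dualVec b i - s * dualVec a i = dualVec (b - s • a) i := by
  rcases i with i | i
  · simp only [dualVec, Sum.elim_inl, Pi.sub_apply, Pi.smul_apply, smul_eq_mul]
    ring
  · simp [dualVec]

theorem dualVec_mem {t : Fin e ⊕ Fin e → K} (ht : ∀ i, t i ∈ J) (i : Fin e ⊕ Fin e) :
    dualVec t i ∈ J := by
  rcases i with i | i <;> simp [dualVec, ht]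

theorem mem_cls_self (a : Fin e ⊕ Fin e → K) : a ∈ cls K e a := ⟨1, by simp⟩

theorem cls_smul (σ : Kˣ) (a : Fin e ⊕ Fin e → K) : cls K e (σ • a) = cls K e a := by
  ext b
  constructor
  · rintro ⟨τ, rfl⟩
    exact ⟨τ * σ, by rw [mul_smul]⟩
  · rintro ⟨τ, rfl⟩
    exact ⟨τ * σ⁻¹, by rw [mul_smul, inv_smul_smul]⟩

theorem cls_eq_of_mem {a b : Fin e ⊕ Fin e → K} (h : b ∈ cls K e a) : cls K e b = cls K e a := by
  obtain ⟨σ, rfl⟩ := h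
  exact cls_smul σ a

theorem cls_mem_classes {a : Fin e ⊕ Fin e → K} (ha : a ∈ unitTuples K e) :
    cls K e a ∈ classes K e := ⟨a, ha, rfl⟩

theorem smul_mem_unitTuples (σ : Kˣ) {a : Fin e ⊕ Fin e → K} (ha : a ∈ unitTuples K e) :
    σ • a ∈ unitTuples K e := by
  obtain ⟨i, hi⟩ := ha
  exact ⟨i, by simpa [Units.smul_def] using hi⟩

theorem mem_unitTuples_of_mem_cls {a b : Fin e ⊕ Fin e → K} (ha : a ∈ unitTuples K e)
    (h : b ∈ cls K e a) : b ∈ unitTuples K e := by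
  obtain ⟨σ, rfl⟩ := h
  exact smul_mem_unitTuples σ ha

theorem eq_of_smul_eq_smul {a : Fin e ⊕ Fin e → K} (ha : a ∈ unitTuples K e) {σ τ : Kˣ}
    (h : σ • a = τ • a) : σ = τ := by
  obtain ⟨i, hi⟩ := ha
  exact Units.ext (hi.mul_right_cancel (congrFun h i))

theorem adjX_cls (a b : Fin e ⊕ Fin e → K) :
    adjX K e (cls K e a) (cls K e b) ↔ sympForm K e a b ≠ 0 := by
  constructor
  · rintro ⟨_, ⟨σ, rfl⟩, _, ⟨τ, rfl⟩, h⟩ h0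
    rw [Units.smul_def, Units.smul_def, sympForm_smul_smul, h0, mul_zero] at h
    exact h rfl
  · exact fun h => ⟨a, mem_cls_self a, b, mem_cls_self b, h⟩

theorem ncard_mul_card_units {𝒞 : Set (Set (Fin e ⊕ Fin e → K))} (h𝒞 : 𝒞 ⊆ classes K e) :
    𝒞.ncard * Nat.card Kˣ = (⋃₀ 𝒞).ncard := by
  choose rep hrep using h𝒞
  rw [← Nat.card_coe_set_eq, ← Nat.card_coe_set_eq, ← Nat.card_prod]
  have hmem : ∀ (p : 𝒞 × Kˣ), p.2 • rep p.1.2 ∈ p.1.1 := fun p =>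
    Set.ext_iff.1 (hrep p.1.2).2 _ |>.2 ⟨p.2, rfl⟩
  refine Nat.card_congr (Equiv.ofBijective
    (fun p : 𝒞 × Kˣ => (⟨p.2 • rep p.1.2, p.1, p.1.2, hmem p⟩ : ⋃₀ 𝒞)) ⟨?_, ?_⟩)
  · rintro ⟨⟨S, hS⟩, σ⟩ ⟨⟨S', hS'⟩, σ'⟩ h
    have h : σ • rep hS = σ' • rep hS' := Subtype.ext_iff.1 h
    have hSS' : S = S' := by
      rw [(hrep hS).2, (hrep hS').2, ← cls_smul σ, h, cls_smul]
    subst hSS'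
    rw [eq_of_smul_eq_smul (hrep hS).1 h]
  · rintro ⟨b, S, hS, hb⟩
    obtain ⟨σ, hσ⟩ := (hrep hS).2 ▸ hb
    exact ⟨⟨⟨S, hS⟩, σ⟩, Subtype.ext hσ.symm⟩

theorem ncard_classes_filter_mul (p : Set (Fin e ⊕ Fin e → K) → Prop) :
    {C ∈ classes K e | p C}.ncard * Nat.card Kˣ
      = {c | c ∈ unitTuples K e ∧ p (cls K e c)}.ncard := by
  rw [ncard_mul_card_units (Set.sep_subset _ _)]
  congr 1
  ext c
  constructor
  · rintro ⟨_, ⟨⟨a, ha, rfl⟩, hp⟩, hc⟩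
    exact ⟨mem_unitTuples_of_mem_cls ha hc, by rwa [cls_eq_of_mem hc]⟩
  · exact fun ⟨hc, hp⟩ => ⟨_, ⟨cls_mem_classes hc, hp⟩, mem_cls_self c⟩

end Symplectic

section Partition

variable {K : Type} [CommRing K] {J : Ideal K} {q e : ℕ}

/-- The classes of the tuples congruent to `a` modulo `J`. -/
def cell (J : Ideal K) (a : Fin e ⊕ Fin e → K) : Set (Set (Fin e ⊕ Fin e → K)) :=
  {S | ∃ t, (∀ i, t i ∈ J) ∧ S = cls K e (a + t)}

theorem cls_mem_cell (a : Fin e ⊕ Fin e → K) : cls K e a ∈ cell J a :=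
  ⟨0, fun _ => J.zero_mem, by rw [add_zero]⟩

theorem cell_smul_add_subset (σ : Kˣ) {a t : Fin e ⊕ Fin e → K} (ht : ∀ i, t i ∈ J) :
    cell J (σ • a + t) ⊆ cell J a := by
  rintro _ ⟨s, hs, rfl⟩
  refine ⟨σ⁻¹ • (t + s), fun i => J.mul_mem_left _ (J.add_mem (ht i) (hs i)), ?_⟩
  rw [← cls_smul σ (a + _), smul_add, smul_inv_smul, add_assoc]

theorem cell_smul_add (σ : Kˣ) {a t : Fin e ⊕ Fin e → K} (ht : ∀ i, t i ∈ J) :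
    cell J (σ • a + t) = cell J a := by
  refine (cell_smul_add_subset σ ht).antisymm ?_
  have h := cell_smul_add_subset (J := J) σ⁻¹ (a := σ • a + t) (t := -(σ⁻¹ • t))
    fun i => J.neg_mem (J.mul_mem_left _ (ht i))
  rwa [smul_add, inv_smul_smul, add_neg_cancel_right] at h

theorem cell_eq_of_cls_mem {a b : Fin e ⊕ Fin e → K} (h : cls K e b ∈ cell J a) :
    cell J b = cell J a := by
  obtain ⟨t, ht, hbt⟩ := h
  obtain ⟨σ, rfl⟩ : b ∈ cls K e (a + t) := hbt ▸ mem_cls_self b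
  rw [smul_add]
  exact cell_smul_add σ fun i => J.mul_mem_left _ (ht i)

theorem IsLengthTwo.cell_subset_classes (hK : IsLengthTwo J q) {a : Fin e ⊕ Fin e → K}
    (ha : a ∈ unitTuples K e) : cell J a ⊆ classes K e := by
  rintro _ ⟨t, ht, rfl⟩
  exact cls_mem_classes (hK.add_mem_unitTuples ha ht)

theorem IsLengthTwo.ncard_cell [Finite K] (hK : IsLengthTwo J q) {a : Fin e ⊕ Fin e → K}
    (ha : a ∈ unitTuples K e) : (cell J a).ncard * q = q ^ (2 * e) := by
  obtain ⟨i, hi⟩ := ha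
  have h := ncard_mem_ideal_and_combination J (w := Pi.single i (1 : K)) (i := i) (by simp)
  simp only [combination_apply, Pi.single_apply, smul_eq_mul, ite_mul, one_mul, zero_mul,
    Finset.sum_ite_eq', Finset.mem_univ, if_true, Fintype.card_sum, Fintype.card_fin,
    hK.card_ideal] at h
  rw [two_mul, ← h]
  congr 1
  symm
  refine Set.ncard_congr (fun t _ => cls K e (a + t)) (fun t ht => ⟨t, ht.1, rfl⟩) ?_ ?_
  · intro t s ht hs hts
    obtain ⟨σ, hσ⟩ : a + t ∈ cls K e (a + s) := hts ▸ mem_cls_self _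
    have h1 := congrFun hσ i
    simp only [Pi.add_apply, Pi.smul_apply, ht.2, hs.2, add_zero, Units.smul_def,
      smul_eq_mul] at h1
    have h2 : σ = 1 := Units.ext (hi.mul_right_cancel (by simpa using h1.symm))
    rwa [h2, one_smul, add_right_inj] at hσ
  · rintro _ ⟨t, ht, rfl⟩
    obtain ⟨u, hu⟩ := hi
    obtain ⟨v, hv⟩ := hK.isUnit_add (⟨u, hu⟩ : IsUnit (a i)) (ht i)
    set σ : Kˣ := u * v⁻¹ with hσ
    have hσJ : (σ : K) - 1 ∈ J := by
      refine mem_of_isUnit_mul_mem v.isUnit ?_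
      have : (v : K) * (σ - 1) = -t i := by
        have h3 : (v : K) * σ = u := by
          rw [hσ, ← Units.val_mul, mul_comm u, mul_inv_cancel_left]
        rw [mul_sub, h3, hv, hu]
        ring
      rw [this]
      exact J.neg_mem (ht i)
    refine ⟨σ • (a + t) - a, ⟨fun j => ?_, ?_⟩, ?_⟩
    · have : (σ • (a + t) - a) j = (σ - 1) * a j + σ * t j := by
        simp only [Pi.sub_apply, Pi.smul_apply, Pi.add_apply, Units.smul_def, smul_eq_mul]
        ring
      rw [this]
      exact J.add_mem (J.mul_mem_right _ hσJ) (J.mul_mem_left _ (ht j))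
    · simp only [Pi.sub_apply, Pi.smul_apply, Pi.add_apply, Units.smul_def, smul_eq_mul]
      rw [← hv, ← hu, hσ, ← Units.val_mul, inv_mul_cancel_right, sub_self]
    · rw [add_sub_cancel, cls_smul]

/-- The set of all cells. -/
def cells (J : Ideal K) (e : ℕ) : Set (Set (Set (Fin e ⊕ Fin e → K))) :=
  {c | ∃ a ∈ unitTuples K e, c = cell J a}

theorem existsUnique_mem_cells {A : Set (Fin e ⊕ Fin e → K)} (hA : A ∈ classes K e) :
    ∃! c, c ∈ cells J e ∧ A ∈ c := by
  obtain ⟨a, ha, rfl⟩ := hA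
  refine ⟨cell J a, ⟨⟨a, ha, rfl⟩, cls_mem_cell a⟩, ?_⟩
  rintro _ ⟨⟨b, hb, rfl⟩, hab⟩
  exact (cell_eq_of_cls_mem hab).symm

theorem IsLengthTwo.ncard_cells_mul [Finite K] (hK : IsLengthTwo J q) {n : ℕ}
    (hn : ∀ c ∈ cells J e, c.ncard = n) : (cells J e).ncard * n = (classes K e).ncard := by
  have hU : classes K e = ⋃ c : cells J e, c.1 := by
    ext A
    simp only [Set.mem_iUnion]
    constructor
    · intro hA
      obtain ⟨c, ⟨hc, hAc⟩, -⟩ := existsUnique_mem_cells (J := J) hA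
      exact ⟨⟨c, hc⟩, hAc⟩
    · rintro ⟨⟨_, a, ha, rfl⟩, hA⟩
      exact hK.cell_subset_classes ha hA
  have := Fintype.ofFinite (cells J e)
  rw [hU, ← Nat.card_coe_set_eq (⋃ c : cells J e, c.1),
    Nat.card_congr (Set.unionEqSigmaOfDisjoint ?_), Nat.card_sigma]
  · simp [hn]
  · intro c d hcd
    refine Set.disjoint_left.2 fun A hAc hAd => hcd (Subtype.ext ?_)
    obtain ⟨b, hb, hc⟩ := c.2
    exact (existsUnique_mem_cells (hK.cell_subset_classes hb (hc ▸ hAc))).unique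
      ⟨c.2, hAc⟩ ⟨d.2, hAd⟩

end Partition

section CommonNeighbours

variable {K : Type} [CommRing K] {J : Ideal K} {q e : ℕ}

/-- The tuples orthogonal to `a`. -/
def orthogonalTuples (a : Fin e ⊕ Fin e → K) : Set (Fin e ⊕ Fin e → K) :=
  {c | combination K (dualVec a) c = 0}

theorem eq_pow_sub_of_mul_pow_eq {q n k N : ℕ} (hq : 0 < q) (hk : k ≤ N)
    (h : n * q ^ k = q ^ N) : n = q ^ (N - k) :=
  Nat.eq_of_mul_eq_mul_right (pow_pos hq k) (by rw [h, Nat.pow_sub_mul_pow q hk])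

theorem IsLengthTwo.ncard_Tset [Finite K] (hK : IsLengthTwo J q) :
    (Tset K J e).ncard = q ^ (2 * e) := by
  rw [Tset, ncard_mem_ideal, hK.card_ideal, Fintype.card_sum, Fintype.card_fin, two_mul]

theorem IsLengthTwo.card_tuples (hK : IsLengthTwo J q) :
    Nat.card (Fin e ⊕ Fin e → K) = q ^ (4 * e) := by
  rw [Nat.card_fun, hK.card_ring, Nat.card_eq_fintype_card, Fintype.card_sum, Fintype.card_fin,
    ← pow_mul]
  congr 1
  omega

theorem IsLengthTwo.ncard_orthogonalTuples [Finite K] (hK : IsLengthTwo J q) (hq : 0 < q)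
    (he : 1 ≤ e) {a : Fin e ⊕ Fin e → K} (ha : a ∈ unitTuples K e) :
    (orthogonalTuples a).ncard = q ^ (4 * e - 2) := by
  obtain ⟨i, hi⟩ := exists_dualVec_isUnit ha
  have h := ncard_combination_eq_zero (M := K) hi
  rw [← Nat.card_eq_fintype_card, ← Nat.card_fun, hK.card_tuples, hK.card_ring] at h
  exact eq_pow_sub_of_mul_pow_eq hq (by omega) h

theorem IsLengthTwo.ncard_Tset_inter_orthogonalTuples [Finite K] (hK : IsLengthTwo J q)
    (hq : 0 < q) (he : 1 ≤ e) {a : Fin e ⊕ Fin e → K} (ha : a ∈ unitTuples K e) :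
    (Tset K J e ∩ orthogonalTuples a).ncard = q ^ (2 * e - 1) := by
  obtain ⟨i, hi⟩ := exists_dualVec_isUnit ha
  have h := ncard_mem_ideal_and_combination J hi
  rw [hK.card_ideal, Fintype.card_sum, Fintype.card_fin, ← two_mul] at h
  exact eq_pow_sub_of_mul_pow_eq hq (by omega) (by rwa [pow_one])

theorem IsLengthTwo.ncard_common_mul_card_units [Finite K] (hK : IsLengthTwo J q) (hq : 0 < q)
    (he : 1 ≤ e) {a b : Fin e ⊕ Fin e → K} (ha : a ∈ unitTuples K e) (hb : b ∈ unitTuples K e) :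
    ({C ∈ classes K e | adjX K e C (cls K e a) ∧ adjX K e C (cls K e b)}.ncard
        * Nat.card Kˣ : ℤ)
      = q ^ (4 * e) - q ^ (2 * e) - 2 * (q ^ (4 * e - 2) - q ^ (2 * e - 1))
        + ((orthogonalTuples a ∩ orthogonalTuples b).ncard
          - (Tset K J e ∩ (orthogonalTuples a ∩ orthogonalTuples b)).ncard) := by
  have hset : {c | c ∈ unitTuples K e ∧ (adjX K e (cls K e c) (cls K e a)
        ∧ adjX K e (cls K e c) (cls K e b))}
      = (Tset K J e)ᶜ \ (orthogonalTuples a ∪ orthogonalTuples b) := by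
    ext c
    rw [Set.mem_ofPred_eq, adjX_cls, adjX_cls, sympForm_swap a c, sympForm_swap b c, neg_ne_zero,
      neg_ne_zero]
    simp only [sympForm_eq_combination,
      hK.mem_unitTuples_iff, Tset, orthogonalTuples, Set.mem_sdiff, Set.mem_compl_iff,
      Set.mem_union, not_or, ne_eq, Set.mem_ofPred_eq]
  rw [← Nat.cast_mul, ncard_classes_filter_mul, hset, ncard_diff_union, hK.card_tuples,
    hK.ncard_Tset, hK.ncard_orthogonalTuples hq he ha, hK.ncard_orthogonalTuples hq he hb,
    hK.ncard_Tset_inter_orthogonalTuples hq he ha, hK.ncard_Tset_inter_orthogonalTuples hq he hb]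
  push_cast
  ring

theorem IsLengthTwo.ncard_inter_of_independent [Finite K] (hK : IsLengthTwo J q) (hq : 0 < q)
    (he : 1 ≤ e) {a b : Fin e ⊕ Fin e → K} (ha : a ∈ unitTuples K e)
    (hab : ∀ s : K, b - s • a ∈ unitTuples K e) :
    (orthogonalTuples a ∩ orthogonalTuples b).ncard = q ^ (4 * e - 4) ∧
      (Tset K J e ∩ (orthogonalTuples a ∩ orthogonalTuples b)).ncard = q ^ (2 * e - 2) := by
  obtain ⟨i, hi⟩ := exists_dualVec_isUnit ha
  have hj (M : Type) [AddCommGroup M] [Module K M] (s : K) :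
      ∃ j, ∀ y ∈ (⊤ : Submodule K M), ∃ x : M, (dualVec b j - s * dualVec a j) • x = y := by
    obtain ⟨j, u, hu⟩ := exists_dualVec_isUnit (hab s)
    exact ⟨j, fun y _ => ⟨(u⁻¹ : Kˣ) • y, by
      rw [dualVec_sub_smul, ← hu]; exact smul_inv_smul u y⟩⟩
  constructor
  · have h := ncard_combination_pair_eq_zero (M := K) ⊤ hi (fun _ => trivial) (hj K)
    rw [← Nat.card_eq_fintype_card, ← Nat.card_fun, hK.card_tuples,
      Nat.card_congr Submodule.topEquiv.toEquiv, hK.card_ring, ← pow_add] at h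
    exact eq_pow_sub_of_mul_pow_eq hq (by omega) h
  · have h := ncard_combination_pair_eq_zero (M := J) ⊤ hi (fun _ => trivial) (hj J)
    rw [Fintype.card_sum, Fintype.card_fin, Nat.card_congr Submodule.topEquiv.toEquiv,
      hK.card_ideal, ← two_mul, ← sq] at h
    refine eq_pow_sub_of_mul_pow_eq hq (by omega) (h ▸ congrArg (· * q ^ 2) ?_)
    refine (ncard_mem_ideal_and J fun c =>
      combination K (dualVec a) c = 0 ∧ combination K (dualVec b) c = 0).trans ?_
    simp only [combination_coe, ZeroMemClass.coe_eq_zero]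

theorem IsLengthTwo.ncard_inter_of_congruent [Finite K] (hK : IsLengthTwo J q) (hq : 0 < q)
    (he : 1 ≤ e) {a t : Fin e ⊕ Fin e → K} (ha : a ∈ unitTuples K e) (ht : ∀ i, t i ∈ J)
    (hat : ∀ s : K, t ≠ s • a) :
    (orthogonalTuples a ∩ orthogonalTuples (a + t)).ncard = q ^ (4 * e - 3) ∧
      (Tset K J e ∩ (orthogonalTuples a ∩ orthogonalTuples (a + t))).ncard
        = q ^ (2 * e - 1) := by
  have hadd (c : Fin e ⊕ Fin e → K) : combination K (dualVec (a + t)) c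
      = combination K (dualVec a) c + combination K (dualVec t) c := by
    rw [show dualVec t = dualVec (a + t) - (1 : K) • dualVec a by
      funext i
      simpa using (dualVec_sub_smul a (a + t) 1 i).symm,
      combination_sub_smul, one_smul, add_sub_cancel]
  have hinter : orthogonalTuples a ∩ orthogonalTuples (a + t)
      = {c | combination K (dualVec a) c = 0 ∧ combination K (dualVec t) c = 0} := by
    ext c
    exact and_congr_right fun h : combination K (dualVec a) c = 0 => by
      simp only [orthogonalTuples, Set.mem_ofPred_eq, hadd, h, zero_add]
  constructor
  · obtain ⟨i, hi⟩ := exists_dualVec_isUnit ha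
    have h := ncard_combination_pair_eq_zero (M := K) J hi (combination_mem (dualVec_mem ht)) ?_
    · rw [← Nat.card_eq_fintype_card, ← Nat.card_fun, hK.card_tuples, hK.card_ring,
        hK.card_ideal, ← pow_succ] at h
      rw [hinter]
      exact eq_pow_sub_of_mul_pow_eq hq (by omega) h
    · intro s
      by_cases hs : ∀ i, (t - s • a) i ∈ J
      · obtain ⟨j, hj⟩ := (exists_dualVec_iff (p := (· ≠ 0)) (fun _ => neg_ne_zero)
          (t - s • a)).2 (Function.ne_iff.1 (sub_ne_zero.2 (hat s)))
        exact ⟨j, dualVec_sub_smul a t s j ▸ hK.exists_mul _ (dualVec_mem hs j) hj⟩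
      · obtain ⟨j, u, hu⟩ := exists_dualVec_isUnit (hK.mem_unitTuples_iff.2 hs)
        exact ⟨j, fun y _ => ⟨(u⁻¹ : Kˣ) • y, by
          rw [dualVec_sub_smul, ← hu]; exact smul_inv_smul u y⟩⟩
  · rw [← hK.ncard_Tset_inter_orthogonalTuples hq he ha, hinter]
    congr 1
    ext c
    refine and_congr_right fun hc => and_iff_left ?_
    rw [combination_apply]
    exact Finset.sum_eq_zero fun i _ => hK.mul_eq_zero _ (dualVec_mem ht i) _ (hc i)

theorem IsLengthTwo.ne_smul_of_cls_ne (hK : IsLengthTwo J q) {a t : Fin e ⊕ Fin e → K}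
    (ha : a ∈ unitTuples K e) (ht : ∀ i, t i ∈ J) (h : cls K e a ≠ cls K e (a + t)) (s : K) :
    t ≠ s • a := by
  rintro rfl
  obtain ⟨i, hi⟩ := ha
  have hs : s ∈ J := mem_of_isUnit_mul_mem hi (by rw [mul_comm]; exact ht i)
  obtain ⟨u, hu⟩ := hK.isUnit_add isUnit_one hs
  refine h ?_
  rw [← cls_smul u a, Units.smul_def, hu, add_smul, one_smul]

theorem IsLengthTwo.sub_smul_mem_unitTuples_of_cell_ne (hK : IsLengthTwo J q) {a b : Fin e ⊕ Fin e → K}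
    (hb : b ∈ unitTuples K e) (h : cell J a ≠ cell J b) (s : K) :
    b - s • a ∈ unitTuples K e := by
  rw [hK.mem_unitTuples_iff]
  intro ht
  by_cases hs : s ∈ J
  · refine hK.mem_unitTuples_iff.1 hb fun i => ?_
    simpa using J.add_mem (ht i) (J.mul_mem_right (a i) hs)
  · obtain ⟨u, rfl⟩ := (hK.isUnit_iff s).2 hs
    refine h ?_
    rw [← cell_smul_add u ht, Units.smul_def, add_sub_cancel]

end CommonNeighbours

section Arithmetic

variable {q D U e : ℕ}

theorem cast_eq_and_ne_zero (hq : 2 ≤ q) (hU : U + q = q ^ 2) :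
    (U : ℤ) = q ^ 2 - q ∧ (U : ℤ) ≠ 0 := by
  have hU' : (U : ℤ) = q ^ 2 - q := by
    rw [eq_sub_iff_add_eq]
    exact_mod_cast hU
  have hU0 : (U : ℤ) ≠ 0 := by
    rw [hU']
    nlinarith
  exact ⟨hU', hU0⟩

theorem parameter_valency (hq : 2 ≤ q) (he : 2 ≤ e) (hU : U + q = q ^ 2)
    (h : (D * U : ℤ) = q ^ (4 * e) - q ^ (2 * e) - 2 * (q ^ (4 * e - 2) - q ^ (2 * e - 1))
      + (q ^ (4 * e - 2) - q ^ (2 * e - 1))) :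
    D = q ^ (4 * e - 2) + q ^ (4 * e - 3) - q ^ (2 * e - 2) := by
  obtain ⟨m, rfl⟩ := Nat.exists_eq_add_of_le he
  obtain ⟨hU', hU0⟩ := cast_eq_and_ne_zero hq hU
  simp only [show 4 * (2 + m) = 4 * m + 8 by ring, show 2 * (2 + m) = 2 * m + 4 by ring,
    Nat.reduceSubDiff] at h ⊢
  have hD : (D : ℤ) + q ^ (2 * m + 2) = q ^ (4 * m + 6) + q ^ (4 * m + 5) := by
    apply mul_right_cancel₀ hU0
    rw [add_mul, h, hU']
    ring
  exact Nat.eq_sub_of_add_eq (by exact_mod_cast hD)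

theorem parameter_same_class (hq : 2 ≤ q) (he : 2 ≤ e) (hU : U + q = q ^ 2)
    (h : (D * U : ℤ) = q ^ (4 * e) - q ^ (2 * e) - 2 * (q ^ (4 * e - 2) - q ^ (2 * e - 1))
      + (q ^ (4 * e - 3) - q ^ (2 * e - 1))) :
    D = q ^ (4 * e - 2) + q ^ (4 * e - 3) - q ^ (4 * e - 4) - q ^ (2 * e - 2) := by
  obtain ⟨m, rfl⟩ := Nat.exists_eq_add_of_le he
  obtain ⟨hU', hU0⟩ := cast_eq_and_ne_zero hq hU
  simp only [show 4 * (2 + m) = 4 * m + 8 by ring, show 2 * (2 + m) = 2 * m + 4 by ring,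
    Nat.reduceSubDiff] at h ⊢
  have hD : (D : ℤ) + (q ^ (4 * m + 4) + q ^ (2 * m + 2))
      = q ^ (4 * m + 6) + q ^ (4 * m + 5) := by
    apply mul_right_cancel₀ hU0
    rw [add_mul, h, hU']
    ring
  rw [Nat.sub_sub]
  exact Nat.eq_sub_of_add_eq (by exact_mod_cast hD)

theorem parameter_distinct_classes (hq : 2 ≤ q) (he : 2 ≤ e) (hU : U + q = q ^ 2)
    (h : (D * U : ℤ) = q ^ (4 * e) - q ^ (2 * e) - 2 * (q ^ (4 * e - 2) - q ^ (2 * e - 1))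
      + (q ^ (4 * e - 4) - q ^ (2 * e - 2))) :
    D = q ^ (4 * e - 2) + q ^ (4 * e - 3) - q ^ (4 * e - 4) - q ^ (4 * e - 5)
      - q ^ (2 * e - 2) + q ^ (2 * e - 3) := by
  obtain ⟨m, rfl⟩ := Nat.exists_eq_add_of_le he
  obtain ⟨hU', hU0⟩ := cast_eq_and_ne_zero hq hU
  simp only [show 4 * (2 + m) = 4 * m + 8 by ring, show 2 * (2 + m) = 2 * m + 4 by ring,
    Nat.reduceSubDiff] at h ⊢
  have hD : (D : ℤ) + (q ^ (4 * m + 4) + q ^ (4 * m + 3) + q ^ (2 * m + 2))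
      = q ^ (4 * m + 6) + q ^ (4 * m + 5) + q ^ (2 * m + 1) := by
    apply mul_right_cancel₀ hU0
    rw [add_mul, h, hU']
    ring
  have hD' : D + (q ^ (4 * m + 4) + q ^ (4 * m + 3) + q ^ (2 * m + 2))
      = q ^ (4 * m + 6) + q ^ (4 * m + 5) + q ^ (2 * m + 1) := by
    exact_mod_cast hD
  have h1 : q ^ (4 * m + 4) ≤ q ^ (4 * m + 5) := Nat.pow_le_pow_right (by omega) (by omega)
  have h2 : q ^ (4 * m + 3) ≤ q ^ (4 * m + 5) := Nat.pow_le_pow_right (by omega) (by omega)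
  have h3 : q ^ (2 * m + 2) ≤ q ^ (4 * m + 5) := Nat.pow_le_pow_right (by omega) (by omega)
  have h4 : 2 * q ^ (4 * m + 5) ≤ q ^ (4 * m + 6) := by
    rw [pow_succ' q (4 * m + 5)]
    exact Nat.mul_le_mul_right _ hq
  rw [Nat.sub_sub, Nat.sub_sub]
  generalize q ^ (4 * m + 5) = x5 at *
  generalize q ^ (4 * m + 6) = x6 at *
  generalize q ^ (4 * m + 4) = x4 at *
  generalize q ^ (4 * m + 3) = x3 at *
  generalize q ^ (2 * m + 2) = y2 at *
  generalize q ^ (2 * m + 1) = y1 at *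
  omega

theorem parameter_card (hq : 2 ≤ q) (he : 1 ≤ e) (hU : U + q = q ^ 2)
    (h : D * U + q ^ (2 * e) = q ^ (4 * e)) :
    D * (q - 1) = q ^ (2 * e - 1) * (q ^ (2 * e) - 1) := by
  obtain ⟨m, rfl⟩ := Nat.exists_eq_add_of_le he
  obtain ⟨p, rfl⟩ := Nat.exists_eq_add_of_le' (by omega : 1 ≤ q)
  have hU' : U = p * (p + 1) := by linarith
  simp only [show 4 * (1 + m) = 4 * m + 4 by ring, show 2 * (1 + m) = 2 * m + 2 by ring,
    Nat.reduceSubDiff, Nat.add_sub_cancel] at h ⊢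
  apply Nat.eq_of_mul_eq_mul_right (by omega : 0 < p + 1)
  rw [mul_assoc, ← hU', Nat.eq_sub_of_add_eq h, Nat.mul_sub, mul_one, Nat.sub_mul]
  congr 1
  ring

end Arithmetic

/-- Theorem 1: `X(2e,K)` is a divisible design graph with the stated parameters. -/
theorem X_is_divisible_design_graph
    (K : Type) [CommRing K] [Fintype K]
    (J : Ideal K) (r : K) (q : ℕ)
    (hJr : J = Ideal.span {r})
    (hJbot : J ≠ ⊥) (hJtop : J ≠ ⊤)
    (hideals : ∀ I : Ideal K, I = ⊥ ∨ I = J ∨ I = ⊤)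
    (hq : IsPrimePow q)
    (hqcard : Nat.card (K ⧸ J) = q)
    (e : ℕ) (he : 2 ≤ e) :
    Nat.card (classes K e) = q ^ (2 * e - 1) * (q ^ (2 * e) - 1) / (q - 1) ∧
    (∀ A ∈ classes K e,
      Nat.card ↥{B ∈ classes K e | adjX K e A B} =
        q ^ (4 * e - 2) + q ^ (4 * e - 3) - q ^ (2 * e - 2)) ∧
    ∃ P : Set (Set (Set (Fin e ⊕ Fin e → K))),
      Nat.card P = (q ^ (2 * e) - 1) / (q - 1) ∧
      (∀ c ∈ P, c ⊆ classes K e ∧ Nat.card c = q ^ (2 * e - 1)) ∧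
      (∀ A ∈ classes K e, ∃! c, c ∈ P ∧ A ∈ c) ∧
      (∀ c ∈ P, ∀ A ∈ c, ∀ B ∈ c, A ≠ B →
        Nat.card ↥{C ∈ classes K e | adjX K e C A ∧ adjX K e C B} =
          q ^ (4 * e - 2) + q ^ (4 * e - 3) - q ^ (4 * e - 4) - q ^ (2 * e - 2)) ∧
      (∀ c₁ ∈ P, ∀ c₂ ∈ P, c₁ ≠ c₂ → ∀ A ∈ c₁, ∀ B ∈ c₂,
        Nat.card ↥{C ∈ classes K e | adjX K e C A ∧ adjX K e C B} =
          q ^ (4 * e - 2) + q ^ (4 * e - 3) - q ^ (4 * e - 4) - q ^ (4 * e - 5)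
            - q ^ (2 * e - 2) + q ^ (2 * e - 3)) := by
  have hK := isLengthTwo_of_ideals hJbot hJtop hideals hqcard
  have hq2 := hq.two_le
  have hq0 : 0 < q := by omega
  have he1 : 1 ≤ e := by omega
  have hU := hK.card_units_add
  have hV : (classes K e).ncard * (q - 1) = q ^ (2 * e - 1) * (q ^ (2 * e) - 1) := by
    refine parameter_card hq2 he1 hU ?_
    have h := ncard_classes_filter_mul (K := K) (e := e) fun _ => True
    simp only [and_true, Set.ofPred_mem_eq] at h
    have hT : unitTuples K e = (Tset K J e)ᶜ := Set.ext fun c => hK.mem_unitTuples_iff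
    rw [h, hT, ← hK.ncard_Tset, ← hK.card_tuples, add_comm]
    exact Set.ncard_add_ncard_compl _
  have hcell : ∀ c ∈ cells J e, c.ncard = q ^ (2 * e - 1) := by
    rintro _ ⟨a, ha, rfl⟩
    exact eq_pow_sub_of_mul_pow_eq hq0 (by omega) (by rw [pow_one, hK.ncard_cell ha])
  have hrep : ∀ c ∈ cells J e, ∀ A ∈ c, ∃ a ∈ unitTuples K e, A = cls K e a ∧ c = cell J a := by
    rintro _ ⟨a, ha, rfl⟩ _ ⟨t, ht, rfl⟩
    exact ⟨a + t, hK.add_mem_unitTuples ha ht, rfl, (cell_eq_of_cls_mem ⟨t, ht, rfl⟩).symm⟩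
  simp only [Nat.card_coe_set_eq]
  refine ⟨?_, ?_, cells J e, ?_, ?_, fun A hA => existsUnique_mem_cells hA, ?_, ?_⟩
  · exact (Nat.div_eq_of_eq_mul_left (by omega) hV.symm).symm
  · rintro _ ⟨a, ha, rfl⟩
    have hset : {B ∈ classes K e | adjX K e (cls K e a) B}
        = {C ∈ classes K e | adjX K e C (cls K e a) ∧ adjX K e C (cls K e a)} := by
      ext C
      refine and_congr_right ?_
      rintro ⟨c, hc, rfl⟩
      rw [and_self_iff, adjX_cls, adjX_cls, sympForm_swap, neg_ne_zero]
    rw [hset]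
    refine parameter_valency hq2 he hU ?_
    rw [hK.ncard_common_mul_card_units hq0 he1 ha ha, Set.inter_self,
      hK.ncard_orthogonalTuples hq0 he1 ha, hK.ncard_Tset_inter_orthogonalTuples hq0 he1 ha]
    push_cast
    rfl
  · have h := hK.ncard_cells_mul hcell
    refine (Nat.div_eq_of_eq_mul_left (by omega) ?_).symm
    apply Nat.eq_of_mul_eq_mul_left (pow_pos hq0 (2 * e - 1))
    rw [← hV, ← h]
    ring
  · intro c hc
    obtain ⟨a, ha, rfl⟩ := id hc
    exact ⟨hK.cell_subset_classes ha, hcell _ hc⟩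
  · intro c hc A hA B hB hAB
    obtain ⟨a, ha, rfl, rfl⟩ := hrep c hc A hA
    obtain ⟨t, ht, rfl⟩ := hB
    obtain ⟨h1, h2⟩ := hK.ncard_inter_of_congruent hq0 he1 ha ht (hK.ne_smul_of_cls_ne ha ht hAB)
    refine parameter_same_class hq2 he hU ?_
    rw [hK.ncard_common_mul_card_units hq0 he1 ha (hK.add_mem_unitTuples ha ht), h1, h2]
    push_cast
    rfl
  · intro c₁ hc₁ c₂ hc₂ hne A hA B hB
    obtain ⟨a, ha, rfl, rfl⟩ := hrep c₁ hc₁ A hA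
    obtain ⟨b, hb, rfl, rfl⟩ := hrep c₂ hc₂ B hB
    obtain ⟨h1, h2⟩ := hK.ncard_inter_of_independent hq0 he1 ha
      (hK.sub_smul_mem_unitTuples_of_cell_ne hb hne)
    refine parameter_distinct_classes hq2 he hU ?_
    rw [hK.ncard_common_mul_card_units hq0 he1 ha hb, h1, h2]
    push_cast
    rfl
end

section
/- Let K be a finite commutative ring with identity having precisely three ideals. Then there exist a principal ideal domain P and a prime element p of P such that K is isomorphic as a ring to the quotient P/⟨p²⟩. -/
theorem Ideal.exists_forall_eq_bot_or_eq_or_eq_top_of_natCard_eq_three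
    {K : Type*} [CommRing K] (h3 : Nat.card (Ideal K) = 3) :
    ∃ m : Ideal K, m ≠ ⊥ ∧ m ≠ ⊤ ∧ ∀ I : Ideal K, I = ⊥ ∨ I = m ∨ I = ⊤ := by
  rw [← Set.ncard_univ, Set.ncard_eq_three] at h3
  obtain ⟨x, y, z, hxy, hxz, hyz, h⟩ := h3
  have hmem : ∀ I : Ideal K, I = x ∨ I = y ∨ I = z := fun I => by
    simpa [h] using Set.mem_univ I
  have hbt : (⊥ : Ideal K) ≠ ⊤ := fun e =>
    hxy ((eq_bot_of_bot_eq_top e x).trans (eq_bot_of_bot_eq_top e y).symm)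
  rcases hmem ⊥ with hb | hb | hb <;> rcases hmem ⊤ with ht | ht | ht <;>
    first
    | exact absurd (hb.trans ht.symm) hbt
    | exact ⟨x, by grind, by grind, fun I => by grind [hmem I]⟩
    | exact ⟨y, by grind, by grind, fun I => by grind [hmem I]⟩
    | exact ⟨z, by grind, by grind, fun I => by grind [hmem I]⟩

section ThreeIdeals

variable {K : Type*} [CommRing K] {m : Ideal K}

theorem Ideal.isMaximal_of_forall_eq_bot_or_eq_or_eq_top (hb : m ≠ ⊥) (ht : m ≠ ⊤)
    (h : ∀ I : Ideal K, I = ⊥ ∨ I = m ∨ I = ⊤) : m.IsMaximal := by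
  refine Ideal.isMaximal_def.mpr ⟨ht, fun J hJ => ?_⟩
  rcases h J with rfl | rfl | rfl
  · exact absurd hJ not_lt_bot
  · exact absurd hJ (lt_irrefl _)
  · rfl

theorem Ideal.span_singleton_eq_of_forall_eq_bot_or_eq_or_eq_top (ht : m ≠ ⊤)
    (h : ∀ I : Ideal K, I = ⊥ ∨ I = m ∨ I = ⊤) {t : K} (htm : t ∈ m) (ht0 : t ≠ 0) :
    Ideal.span {t} = m := by
  rcases h (Ideal.span {t}) with e | e | e
  · exact absurd (Ideal.span_singleton_eq_bot.mp e) ht0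
  · exact e
  · exact absurd (top_le_iff.mp (e ▸ (Ideal.span_singleton_le_iff_mem m).mpr htm)) ht

theorem Ideal.mul_eq_zero_of_forall_eq_bot_or_eq_or_eq_top (ht : m ≠ ⊤)
    (h : ∀ I : Ideal K, I = ⊥ ∨ I = m ∨ I = ⊤) {x y : K} (hx : x ∈ m) (hy : y ∈ m) :
    x * y = 0 := by
  by_contra hxy
  have hx0 : x ≠ 0 := left_ne_zero_of_mul hxy
  have hspan := Ideal.span_singleton_eq_of_forall_eq_bot_or_eq_or_eq_top ht h
    (m.mul_mem_left x hy) hxy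
  obtain ⟨c, hc⟩ := Ideal.mem_span_singleton.mp (hspan ▸ hx)
  have hu : (1 - y * c) ∉ m := fun hm =>
    (Ideal.ne_top_iff_one m).mp ht (by simpa using m.add_mem hm (m.mul_mem_right c hy))
  have hz : x * (1 - y * c) = 0 := by linear_combination hc
  rcases h (Ideal.span {1 - y * c}) with e | e | e
  · exact hu (by simp [Ideal.span_singleton_eq_bot.mp e])
  · exact hu (e ▸ Ideal.mem_span_singleton_self _)
  · exact hx0 ((Ideal.span_singleton_eq_top.mp e).mul_left_eq_zero.mp hz)

end ThreeIdeals

theorem RingHom.ker_eq_span_sq_of_prime {Q K : Type*} [CommRing Q] [IsDomain Q]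
    [IsPrincipalIdealRing Q] [CommRing K] {p : Q} (hp : Prime p) (f : Q →+* K)
    (h0 : f p ≠ 0) (h2 : f p ^ 2 = 0) : RingHom.ker f = Ideal.span {p ^ 2} := by
  obtain ⟨g, hg⟩ := IsPrincipalIdealRing.principal (RingHom.ker f)
  replace hg : RingHom.ker f = Ideal.span {g} := hg
  have hmem : p ^ 2 ∈ Ideal.span {g} := by rw [← hg]; simpa [RingHom.mem_ker] using h2
  obtain ⟨i, hi, ha⟩ := (dvd_prime_pow hp 2).mp (Ideal.mem_span_singleton.mp hmem)
  have hi2 : i = 2 := by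
    by_contra hne
    have hgp : g ∣ p := ha.dvd.trans ((pow_dvd_pow p (by omega : i ≤ 1)).trans (by simp))
    exact h0 (RingHom.mem_ker.mp (hg ▸ Ideal.mem_span_singleton.mpr hgp))
  rw [hg, ← hi2]
  exact Ideal.span_singleton_eq_span_singleton.mpr ha

theorem exists_commRingCat_quotient_sq_of_surjective {Q : Type} {K : Type*} [CommRing Q]
    [IsDomain Q] [IsPrincipalIdealRing Q] [CommRing K] {p : Q} (hp : Prime p) (f : Q →+* K)
    (h0 : f p ≠ 0) (h2 : f p ^ 2 = 0) (hf : ∀ y, ∃ q c, y = f q + f p * c) :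
    ∃ (P : CommRingCat) (p : ↥P), IsDomain ↥P ∧ IsPrincipalIdealRing ↥P ∧ Prime p ∧
      Nonempty (K ≃+* ↥P ⧸ Ideal.span {p ^ 2}) := by
  have hsurj : Function.Surjective f := fun y => by
    obtain ⟨q, c, rfl⟩ := hf y
    obtain ⟨q', c', rfl⟩ := hf c
    exact ⟨q + p * q', by simp only [map_add, map_mul]; linear_combination -c' * h2⟩
  let e : ULift Q ≃+* Q := ULift.ringEquiv
  let F : ULift Q →+* K := f.comp (e : ULift Q →+* Q)
  have hP : IsPrincipalIdealRing (ULift Q) :=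
    IsPrincipalIdealRing.of_surjective e.symm e.symm.surjective
  have hD : IsDomain (ULift Q) := e.toMulEquiv.isDomain Q
  have hp' : Prime (e.symm p) := (MulEquiv.prime_iff e.symm).mpr hp
  have hker := RingHom.ker_eq_span_sq_of_prime hp' F (by simpa [F] using h0)
    (by simpa [F] using h2)
  exact ⟨CommRingCat.of (ULift Q), e.symm p, hD, hP, hp',
    ⟨((Ideal.quotEquivOfEq hker.symm).trans
      (RingHom.quotientKerEquivOfSurjective (f := F) (hsurj.comp e.surjective))).symm⟩⟩

section ResidueField

variable {K k : Type*} [CommRing K] [Field k]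

theorem exists_section_of_sq_zero_of_charP [Fintype k] (p n : ℕ) [Fact p.Prime] [CharP K p]
    (hn : n ≠ 0) (hk : Fintype.card k = p ^ n) (π : K →+* k) (hπ : Function.Surjective π)
    (hsq : ∀ x y, π x = 0 → π y = 0 → x * y = 0) :
    ∃ s : k →+* K, ∀ a, π (s a) = a := by
  have hker : RingHom.ker π ≤ RingHom.ker (iterateFrobenius K p n) := fun x hx => by
    rw [RingHom.mem_ker] at hx ⊢
    rw [iterateFrobenius_def]
    have h2 : 2 ≤ p ^ n := (Fact.out : p.Prime).two_le.trans (Nat.le_self_pow hn p)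
    exact pow_eq_zero_of_le h2 (by rw [pow_two]; exact hsq x x hx hx)
  refine ⟨RingHom.liftOfSurjective π hπ ⟨_, hker⟩, fun a => ?_⟩
  obtain ⟨x, rfl⟩ := hπ a
  have : RingHom.liftOfSurjective π hπ ⟨_, hker⟩ (π x) = iterateFrobenius K p n x :=
    RingHom.liftOfRightInverse_comp_apply ..
  rw [this, iterateFrobenius_def, map_pow, ← hk, FiniteField.pow_card]

theorem WittVector.exists_ringHom_coeff_zero_pow (p : ℕ) [Fact p.Prime] (hp : (p : k) = 0)
    (π : K →+* k) (hπ : Function.Surjective π)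
    (hsq : ∀ x y, π x = 0 → π y = 0 → x * y = 0) :
    ∃ f : WittVector p k →+* K, ∀ x, π (f x) = x.coeff 0 ^ p := by
  have hval : ∀ x : WittVector p K,
      WittVector.ghostComponent 1 x = p * x.coeff 1 + x.coeff 0 ^ p := fun x => by
    simp [WittVector.ghostComponent_apply, wittPolynomial_one]
  have hs := WittVector.map_surjective (p := p) π hπ
  have hker : RingHom.ker (WittVector.map (p := p) π) ≤
      RingHom.ker (WittVector.ghostComponent (p := p) (R := K) 1) := fun x hx => by
    rw [RingHom.mem_ker] at hx ⊢
    have hc : ∀ i, π (x.coeff i) = 0 := fun i => by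
      rw [← WittVector.map_coeff, hx, WittVector.zero_coeff]
    rw [hval, hsq _ _ (by simpa using hp) (hc 1), zero_add]
    exact pow_eq_zero_of_le (Fact.out : p.Prime).two_le
      (by rw [pow_two]; exact hsq _ _ (hc 0) (hc 0))
  refine ⟨RingHom.liftOfSurjective _ hs ⟨_, hker⟩, fun a => ?_⟩
  obtain ⟨x, rfl⟩ := hs a
  have : RingHom.liftOfSurjective _ hs ⟨_, hker⟩ (WittVector.map π x) =
      WittVector.ghostComponent 1 x := RingHom.liftOfRightInverse_comp_apply ..
  rw [this, hval, WittVector.map_coeff]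
  simp [hp]

end ResidueField

/-- Lemma: a finite commutative ring with identity having precisely three ideals is
isomorphic to `P/⟨p²⟩` for some PID `P` and prime `p ∈ P`. -/
theorem ring_with_three_ideals_iso_quotient_of_pid
    (K : Type) [CommRing K] [Fintype K]
    (h3 : Nat.card (Ideal K) = 3) :
    ∃ (P : CommRingCat) (p : ↥P), IsDomain ↥P ∧ IsPrincipalIdealRing ↥P ∧ Prime p ∧
      Nonempty (K ≃+* ↥P ⧸ Ideal.span {p ^ 2}) := by
  obtain ⟨m, hb, ht, h⟩ := Ideal.exists_forall_eq_bot_or_eq_or_eq_top_of_natCard_eq_three h3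
  have hmax := Ideal.isMaximal_of_forall_eq_bot_or_eq_or_eq_top hb ht h
  let _ : Field (K ⧸ m) := Ideal.Quotient.field m
  have _ : Fintype (K ⧸ m) := Fintype.ofFinite _
  let π := Ideal.Quotient.mk m
  have hπ : Function.Surjective π := Ideal.Quotient.mk_surjective
  have hmem : ∀ {x}, π x = 0 ↔ x ∈ m := Ideal.Quotient.eq_zero_iff_mem
  have hsq : ∀ x y, π x = 0 → π y = 0 → x * y = 0 := fun x y hx hy =>
    Ideal.mul_eq_zero_of_forall_eq_bot_or_eq_or_eq_top ht h (hmem.mp hx) (hmem.mp hy)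
  have hdvd : ∀ {t x}, π t = 0 → t ≠ 0 → π x = 0 → t ∣ x := fun htm ht0 hx => by
    rw [← Ideal.mem_span_singleton,
      Ideal.span_singleton_eq_of_forall_eq_bot_or_eq_or_eq_top ht h (hmem.mp htm) ht0]
    exact hmem.mp hx
  obtain ⟨p, _, n, hp, hk⟩ := FiniteField.card' (K ⧸ m)
  have _ : Fact p.Prime := ⟨hp⟩
  have hpk : (p : K ⧸ m) = 0 := CharP.cast_eq_zero _ p
  by_cases hpK : (p : K) = 0
  · have _ : Nontrivial K := π.domain_nontrivial
    have _ : CharP K p := (CharP.charP_iff_prime_eq_zero hp).mpr hpK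
    obtain ⟨s, hs⟩ := exists_section_of_sq_zero_of_charP p n n.ne_zero hk π hπ hsq
    obtain ⟨t, htm, ht0⟩ := m.ne_bot_iff.mp hb
    rw [← hmem] at htm
    refine exists_commRingCat_quotient_sq_of_surjective Polynomial.prime_X
      (Polynomial.eval₂RingHom s t) (by simpa using ht0)
      (by simpa [pow_two] using hsq t t htm htm) fun y => ?_
    obtain ⟨c, hc⟩ := hdvd htm ht0 (x := y - s (π y)) (by simp [hs])
    exact ⟨Polynomial.C (π y), c, by simpa using eq_add_of_sub_eq' hc⟩
  · have hpπ : π p = 0 := by simp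
    obtain ⟨f, hf⟩ := WittVector.exists_ringHom_coeff_zero_pow p hpk π hπ hsq
    refine exists_commRingCat_quotient_sq_of_surjective (WittVector.irreducible p).prime f
      (by simpa using hpK) (by simpa [pow_two] using hsq _ _ hpπ hpπ) fun y => ?_
    obtain ⟨a, ha⟩ := surjective_frobenius (K ⧸ m) p (π y)
    obtain ⟨c, hc⟩ := hdvd hpπ hpK (x := y - f (WittVector.teichmuller p a))
      (by rw [map_sub, hf, WittVector.teichmuller_coeff_zero, ← ha, frobenius_def, sub_self])
    exact ⟨_, c, by simpa using eq_add_of_sub_eq' hc⟩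
end

section
/- Let Z = {z_1, …, z_q} ⊆ K be a complete set of coset representatives for J in K (so K/J = {z_1+J, …, z_q+J} with the z_i pairwise non-congruent modulo J). Then J = {z_1·r, z_2·r, …, z_q·r} with these q elements pairwise distinct, and K = {z_{j1} + z_{j2}·r : j1, j2 ∈ {1,…,q}} with these q² elements pairwise distinct; in particular |J| = q and |K| = q². -/
section UniqueNontrivialIdeal

variable {K : Type*} [CommRing K] {J : Ideal K}

/-- If every ideal is `⊥`, `J` or `⊤`, then the elements outside `J` are units. -/
theorem isUnit_of_notMem_of_ideals_trichotomy
    (hideals : ∀ I : Ideal K, I = ⊥ ∨ I = J ∨ I = ⊤) {a : K} (ha : a ∉ J) : IsUnit a := by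
  have hmem : a ∈ Ideal.span {a} := Ideal.mem_span_singleton_self a
  rcases hideals (Ideal.span {a}) with h | h | h
  · exact absurd (Ideal.span_singleton_eq_bot.mp h ▸ J.zero_mem) ha
  · exact absurd (h ▸ hmem) ha
  · exact Ideal.span_singleton_eq_top.mp h

/-- A generator of the unique nontrivial ideal has square zero. -/
theorem generator_mul_self_eq_zero_of_ideals_trichotomy {r : K}
    (hJr : J = Ideal.span {r}) (hJtop : J ≠ ⊤)
    (hideals : ∀ I : Ideal K, I = ⊥ ∨ I = J ∨ I = ⊤) : r * r = 0 := by
  have hr : r ∈ J := hJr ▸ Ideal.mem_span_singleton_self r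
  rcases hideals (Ideal.span {r * r}) with h | h | h
  · exact Ideal.span_singleton_eq_bot.mp h
  · obtain ⟨c, hc⟩ := Ideal.mem_span_singleton'.mp (h ▸ hr)
    have hunit : IsUnit (1 - c * r) := by
      refine isUnit_of_notMem_of_ideals_trichotomy hideals fun hmem => hJtop ?_
      rw [Ideal.eq_top_iff_one]
      simpa using J.add_mem hmem (J.mul_mem_left c hr)
    have hr0 : r = 0 := hunit.mul_left_eq_zero.mp (by linear_combination -hc)
    simp [hr0]
  · exact absurd (J.eq_top_of_isUnit_mem (J.mul_mem_left r hr)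
      (Ideal.span_singleton_eq_top.mp h)) hJtop

/-- The annihilator of a generator of the unique nontrivial ideal `J` is `J` itself. -/
theorem mul_generator_eq_zero_iff_mem_of_ideals_trichotomy {r : K}
    (hJr : J = Ideal.span {r}) (hJbot : J ≠ ⊥) (hJtop : J ≠ ⊤)
    (hideals : ∀ I : Ideal K, I = ⊥ ∨ I = J ∨ I = ⊤) {x : K} : x * r = 0 ↔ x ∈ J := by
  constructor
  · intro hx
    by_contra hxJ
    have hr0 : r = 0 :=
      (isUnit_of_notMem_of_ideals_trichotomy hideals hxJ).mul_right_eq_zero.mp hx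
    exact hJbot (hJr.trans (Ideal.span_singleton_eq_bot.mpr hr0))
  · intro hx
    obtain ⟨c, rfl⟩ := Ideal.mem_span_singleton'.mp (hJr ▸ hx)
    rw [mul_assoc, generator_mul_self_eq_zero_of_ideals_trichotomy hJr hJtop hideals, mul_zero]

end UniqueNontrivialIdeal

/-- Lemma: if `{z_1,…,z_q}` is a complete set of coset representatives for `J = ⟨r⟩`
in `K`, then `J = {z_1·r,…,z_q·r}` with these `q` elements pairwise distinct, and
`K = {z_{j1} + z_{j2}·r}` with these `q²` elements pairwise distinct; in particular
`|J| = q` and `|K| = q²`. -/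
theorem coset_representatives_describe_J_and_K
    (K : Type) [CommRing K] [Fintype K]
    (J : Ideal K) (r : K) (q : ℕ)
    (hJr : J = Ideal.span {r})
    (hJbot : J ≠ ⊥) (hJtop : J ≠ ⊤)
    (hideals : ∀ I : Ideal K, I = ⊥ ∨ I = J ∨ I = ⊤)
    (hq : IsPrimePow q)
    (hqcard : Nat.card (K ⧸ J) = q)
    (z : Fin q → K)
    (hz : Function.Bijective fun j => Ideal.Quotient.mk J (z j)) :
    (Set.range (fun j : Fin q => z j * r) = (J : Set K) ∧
      Function.Injective (fun j : Fin q => z j * r)) ∧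
    (Set.range (fun p : Fin q × Fin q => z p.1 + z p.2 * r) = Set.univ ∧
      Function.Injective (fun p : Fin q × Fin q => z p.1 + z p.2 * r)) ∧
    Nat.card J = q ∧ Nat.card K = q ^ 2 := by
  have hmul (x y : K) :
      x * r = y * r ↔ Ideal.Quotient.mk J x = Ideal.Quotient.mk J y := by
    rw [Ideal.Quotient.eq, ← mul_generator_eq_zero_iff_mem_of_ideals_trichotomy
      hJr hJbot hJtop hideals, sub_mul, sub_eq_zero]
  have hmem (x : K) : x * r ∈ J := hJr ▸ Ideal.mem_span_singleton'.mpr ⟨x, rfl⟩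
  have hJrange : Set.range (fun j : Fin q => z j * r) = (J : Set K) := by
    ext x
    constructor
    · rintro ⟨j, rfl⟩
      exact hmem (z j)
    · intro hx
      obtain ⟨c, rfl⟩ := Ideal.mem_span_singleton'.mp (hJr ▸ hx : x ∈ Ideal.span {r})
      obtain ⟨j, hj⟩ := hz.2 (Ideal.Quotient.mk J c)
      exact ⟨j, (hmul _ _).mpr hj⟩
  have hJinj : Function.Injective (fun j : Fin q => z j * r) :=
    fun i j hij => hz.1 ((hmul _ _).mp hij)
  have hKsurj : Function.Surjective (fun p : Fin q × Fin q => z p.1 + z p.2 * r) := by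
    intro x
    obtain ⟨i, hi⟩ := hz.2 (Ideal.Quotient.mk J x)
    have hxi : x - z i ∈ (J : Set K) := Ideal.Quotient.eq.mp hi.symm
    rw [← hJrange] at hxi
    obtain ⟨j, hj⟩ := hxi
    exact ⟨(i, j), by linear_combination hj⟩
  have hKinj : Function.Injective (fun p : Fin q × Fin q => z p.1 + z p.2 * r) := by
    rintro ⟨i, j⟩ ⟨i', j'⟩ h
    have h' : z i + z j * r = z i' + z j' * r := h
    obtain rfl : i = i' := by
      refine hz.1 (Ideal.Quotient.eq.mpr ?_)
      rw [show z i - z i' = (z j' - z j) * r by linear_combination h']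
      exact hmem _
    rw [hJinj (add_left_cancel h')]
  refine ⟨⟨hJrange, hJinj⟩, ⟨hKsurj.range_eq, hKinj⟩, ?_, ?_⟩
  · change Nat.card (J : Set K) = q
    rw [← hJrange, Nat.card_range_of_injective hJinj, Nat.card_fin]
  · rw [← Nat.card_eq_of_bijective _ ⟨hKinj, hKsurj⟩, Nat.card_prod, Nat.card_fin, sq]
end
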